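/- Let K = (T, A)_ω be an ALCHIO weighted knowledge base and q a Boolean conjunctive query. There exists a polynomial p (depending only on T and q, not on A and not on k) such that for every integer k: if there exists an interpretation I with ω(I) ≤ k and I ⊭ q, then there exists an interpretation J with ω(J) ≤ k, J ⊭ q, and |Δ^J| ≤ p(|A|). -/

import Mathlib

namespace DL

/-! ### Syntax -/

abbrev IndName := ℕ
abbrev CName := ℕ
abbrev RName := ℕ

/-- Roles: role names and inverse roles. -/
inductive Role where
  | name : RName → Role
  | inv  : RName → Role
deriving DecidableEq

/-- `ALCHIO` concepts. -/
inductive Concept where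
  | top  : Concept
  | bot  : Concept
  | atom : CName → Concept
  | nom  : IndName → Concept
  | neg  : Concept → Concept
  | conj : Concept → Concept → Concept
  | ex   : Role → Concept → Concept
deriving DecidableEq

/-- TBox axioms: concept inclusions and role inclusions. -/
inductive Axiom where
  | ci : Concept → Concept → Axiom
  | ri : Role → Role → Axiom
deriving DecidableEq

/-- ABox assertions. -/
inductive Assertion where
  | ca : CName → IndName → Assertion
  | ra : RName → IndName → IndName → Assertion
deriving DecidableEq

/-! ### Interpretations -/

/-- A DL interpretation with domain a subset of a universe `U`.  Individual names are
interpreted via `indI` (under the standard names assumption, the individual names of the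
ABox under consideration are interpreted "as themselves", i.e. injectively). -/
structure Interp (U : Type) where
  dom : Set U
  indI : IndName → U
  cI : CName → Set U
  rI : RName → Set (U × U)
  cI_sub : ∀ A, cI A ⊆ dom
  rI_sub : ∀ r p, p ∈ rI r → p.1 ∈ dom ∧ p.2 ∈ dom

variable {U : Type}

/-- Every individual name denotes an element of the domain. -/
def Interp.Proper (I : Interp U) : Prop := ∀ a, I.indI a ∈ I.dom

def Role.interp (I : Interp U) : Role → Set (U × U)
  | Role.name r => I.rI r
  | Role.inv r  => {p | (p.2, p.1) ∈ I.rI r}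

def Concept.interp (I : Interp U) : Concept → Set U
  | Concept.top => I.dom
  | Concept.bot => ∅
  | Concept.atom A => I.cI A
  | Concept.nom a => {I.indI a} ∩ I.dom
  | Concept.neg C => I.dom \ Concept.interp I C
  | Concept.conj C D => Concept.interp I C ∩ Concept.interp I D
  | Concept.ex r C => {d | ∃ e, (d, e) ∈ Role.interp I r ∧ e ∈ Concept.interp I C}

def Assertion.sat (I : Interp U) : Assertion → Prop
  | Assertion.ca A a => I.indI a ∈ I.cI A
  | Assertion.ra r a b => (I.indI a, I.indI b) ∈ I.rI r

/-! ### Violations and cost -/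

/-- Violations of a concept inclusion `C ⊑ D`. -/
def vioCI (I : Interp U) (C D : Concept) : Set U :=
  Concept.interp I C \ Concept.interp I D

/-- Violations of a role inclusion `r ⊑ s`. -/
def vioRI (I : Interp U) (r s : Role) : Set (U × U) :=
  Role.interp I r \ Role.interp I s

/-- The number of violations of an axiom. -/
noncomputable def Axiom.vioCount (I : Interp U) : Axiom → ℕ∞
  | Axiom.ci C D => (vioCI I C D).encard
  | Axiom.ri r s => (vioRI I r s).encard

open Classical in
/-- The cost of an interpretation w.r.t. a weighted knowledge base `(T, A)` with weight
functions `wT` (on TBox axioms) and `wA` (on ABox assertions). -/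
noncomputable def cost (T : Finset Axiom) (A : Finset Assertion)
    (wT : Axiom → ℕ∞) (wA : Assertion → ℕ∞) (I : Interp U) : ℕ∞ :=
  (∑ τ ∈ T, wT τ * Axiom.vioCount I τ) +
    ∑ α ∈ A, (if Assertion.sat I α then 0 else wA α)

/-! ### Queries -/

inductive Term where
  | var : ℕ → Term
  | ind : IndName → Term
deriving DecidableEq

inductive QAtom where
  | ca : CName → Term → QAtom
  | ra : RName → Term → Term → QAtom
deriving DecidableEq

/-- A Boolean conjunctive query: a finite set of atoms, all of whose variables are
(implicitly) existentially quantified. -/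
abbrev BCQ := Finset QAtom

def Term.eval (I : Interp U) (π : ℕ → U) : Term → U
  | Term.var v => π v
  | Term.ind a => I.indI a

def QAtom.sat (I : Interp U) (π : ℕ → U) : QAtom → Prop
  | QAtom.ca A t => Term.eval I π t ∈ I.cI A
  | QAtom.ra r t t' => (Term.eval I π t, Term.eval I π t') ∈ I.rI r

/-- Satisfaction of a BCQ in an interpretation. -/
def satQ (I : Interp U) (q : BCQ) : Prop :=
  ∃ π : ℕ → U, (∀ v, π v ∈ I.dom) ∧ ∀ a ∈ q, QAtom.sat I π a

/-- An instance query is a BCQ with a single atom. -/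
def IsIQ (q : BCQ) : Prop := ∃ a : QAtom, q = {a}

/-! ### Cost-based semantics -/

/-- `k`-satisfiability: some interpretation has cost at most `k`. -/
def ksat (T : Finset Axiom) (A : Finset Assertion)
    (wT : Axiom → ℕ∞) (wA : Assertion → ℕ∞) (k : ℕ) : Prop :=
  ∃ (U : Type) (I : Interp U), I.Proper ∧ cost T A wT wA I ≤ (k : ℕ∞)

/-- `K ⊨ₚᵏ q`: some interpretation of cost at most `k` satisfies `q`. -/
def satP (T : Finset Axiom) (A : Finset Assertion)
    (wT : Axiom → ℕ∞) (wA : Assertion → ℕ∞) (k : ℕ) (q : BCQ) : Prop :=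
  ∃ (U : Type) (I : Interp U), I.Proper ∧ cost T A wT wA I ≤ (k : ℕ∞) ∧ satQ I q

/-- `K ⊨꜀ᵏ q`: every interpretation of cost at most `k` satisfies `q`. -/
def satC (T : Finset Axiom) (A : Finset Assertion)
    (wT : Axiom → ℕ∞) (wA : Assertion → ℕ∞) (k : ℕ) (q : BCQ) : Prop :=
  ∀ (U : Type) (I : Interp U), I.Proper → cost T A wT wA I ≤ (k : ℕ∞) → satQ I q

/-- The optimal cost of a weighted knowledge base. -/
noncomputable def optCost (T : Finset Axiom) (A : Finset Assertion)
    (wT : Axiom → ℕ∞) (wA : Assertion → ℕ∞) : ℕ∞ :=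
  sInf {c : ℕ∞ | ∃ (U : Type) (I : Interp U), I.Proper ∧ cost T A wT wA I = c}

/-- `K ⊨ₚᵒᵖᵗ q`: some interpretation of optimal cost satisfies `q`. -/
noncomputable def satPopt (T : Finset Axiom) (A : Finset Assertion)
    (wT : Axiom → ℕ∞) (wA : Assertion → ℕ∞) (q : BCQ) : Prop :=
  ∃ (U : Type) (I : Interp U), I.Proper ∧ cost T A wT wA I = optCost T A wT wA ∧ satQ I q

/-- `K ⊨꜀ᵒᵖᵗ q`: every interpretation of optimal cost satisfies `q`. -/
noncomputable def satCopt (T : Finset Axiom) (A : Finset Assertion)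
    (wT : Axiom → ℕ∞) (wA : Assertion → ℕ∞) (q : BCQ) : Prop :=
  ∀ (U : Type) (I : Interp U), I.Proper → cost T A wT wA I = optCost T A wT wA → satQ I q

/-! ### Occurrences of symbols -/

def Role.base : Role → RName
  | Role.name r => r
  | Role.inv r => r

def Concept.cnames : Concept → Finset CName
  | Concept.atom A => {A}
  | Concept.neg C => C.cnames
  | Concept.conj C D => C.cnames ∪ D.cnames
  | Concept.ex _ C => C.cnames
  | _ => ∅

def Concept.rnames : Concept → Finset RName
  | Concept.neg C => C.rnames
  | Concept.conj C D => C.rnames ∪ D.rnames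
  | Concept.ex r C => insert r.base C.rnames
  | _ => ∅

def Concept.indNames : Concept → Finset IndName
  | Concept.nom a => {a}
  | Concept.neg C => C.indNames
  | Concept.conj C D => C.indNames ∪ D.indNames
  | Concept.ex _ C => C.indNames
  | _ => ∅

def Axiom.cnames : Axiom → Finset CName
  | Axiom.ci C D => C.cnames ∪ D.cnames
  | Axiom.ri _ _ => ∅

def Axiom.rnames : Axiom → Finset RName
  | Axiom.ci C D => C.rnames ∪ D.rnames
  | Axiom.ri r s => {r.base, s.base}

def Axiom.indNames : Axiom → Finset IndName
  | Axiom.ci C D => C.indNames ∪ D.indNames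
  | Axiom.ri _ _ => ∅

def Assertion.cnames : Assertion → Finset CName
  | Assertion.ca A _ => {A}
  | Assertion.ra _ _ _ => ∅

def Assertion.rnames : Assertion → Finset RName
  | Assertion.ca _ _ => ∅
  | Assertion.ra r _ _ => {r}

def Assertion.indNames : Assertion → Finset IndName
  | Assertion.ca _ a => {a}
  | Assertion.ra _ a b => {a, b}

/-- The individual names occurring in an ABox. -/
def aboxInds (A : Finset Assertion) : Finset IndName := A.biUnion Assertion.indNames

/-- The individual names occurring in a KB. -/
def kbInds (T : Finset Axiom) (A : Finset Assertion) : Finset IndName :=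
  T.biUnion Axiom.indNames ∪ aboxInds A

def Term.indNames : Term → Finset IndName
  | Term.var _ => ∅
  | Term.ind a => {a}

def QAtom.indNames : QAtom → Finset IndName
  | QAtom.ca _ t => t.indNames
  | QAtom.ra _ t t' => t.indNames ∪ t'.indNames

def QAtom.cnames : QAtom → Finset CName
  | QAtom.ca A _ => {A}
  | QAtom.ra _ _ _ => ∅

def qInds (q : BCQ) : Finset IndName := q.biUnion QAtom.indNames

def qCnames (q : BCQ) : Finset CName := q.biUnion QAtom.cnames

/-! ### Sizes -/

def Concept.size : Concept → ℕ
  | Concept.top => 1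
  | Concept.bot => 1
  | Concept.atom _ => 1
  | Concept.nom _ => 1
  | Concept.neg C => C.size + 1
  | Concept.conj C D => C.size + D.size + 1
  | Concept.ex _ C => C.size + 2

def Axiom.size : Axiom → ℕ
  | Axiom.ci C D => C.size + D.size + 1
  | Axiom.ri _ _ => 3

def Assertion.size : Assertion → ℕ
  | Assertion.ca _ _ => 2
  | Assertion.ra _ _ _ => 3

def tboxSize (T : Finset Axiom) : ℕ := ∑ τ ∈ T, τ.size

def aboxSize (A : Finset Assertion) : ℕ := ∑ α ∈ A, α.size

/-! ### DL-Lite fragments -/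

/-- Basic concepts: concept names and unqualified existential restrictions `∃r` (with a
possibly inverse role `r`), the latter rendered as `∃r.⊤`. -/
inductive IsBasic : Concept → Prop
  | atom (A : CName) : IsBasic (Concept.atom A)
  | ex (r : Role) : IsBasic (Concept.ex r Concept.top)

/-- A `DL-Lite_core` axiom: `B ⊑ C` or `B ⊓ C ⊑ ⊥` with `B, C` basic concepts. -/
def IsCoreAxiom (τ : Axiom) : Prop :=
  (∃ B C, τ = Axiom.ci B C ∧ IsBasic B ∧ IsBasic C) ∨
  (∃ B C, τ = Axiom.ci (Concept.conj B C) Concept.bot ∧ IsBasic B ∧ IsBasic C)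

def IsDLLiteCore (T : Finset Axiom) : Prop := ∀ τ ∈ T, IsCoreAxiom τ

/-- Concepts built from basic concepts using `¬`, `⊓` (and hence also `⊔`). -/
inductive IsBoolConcept : Concept → Prop
  | basic {C} : IsBasic C → IsBoolConcept C
  | neg {C} : IsBoolConcept C → IsBoolConcept (Concept.neg C)
  | conj {C D} : IsBoolConcept C → IsBoolConcept D → IsBoolConcept (Concept.conj C D)

/-- A `DL-Lite_bool^H` axiom: a concept inclusion between Boolean combinations of basic
concepts, or a role inclusion. -/
def IsBoolHAxiom (τ : Axiom) : Prop :=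
  (∃ C D, τ = Axiom.ci C D ∧ IsBoolConcept C ∧ IsBoolConcept D) ∨ (∃ r s, τ = Axiom.ri r s)

def IsDLLiteBoolH (T : Finset Axiom) : Prop := ∀ τ ∈ T, IsBoolHAxiom τ

/-! ### Construction -/

section Construction

open Classical

/-- Step along a concept slot to a chosen witness (staying put when not applicable). -/
noncomputable def stepI (I : Interp U) (d : U) (C : Concept) : U :=
  if h : ∃ e r E, C = Concept.ex r E ∧ (d, e) ∈ Role.interp I r ∧ e ∈ Concept.interp I E
  then h.choose else d

theorem role_dom (I : Interp U) (r : Role) (p : U × U) (h : p ∈ Role.interp I r) :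
    p.1 ∈ I.dom ∧ p.2 ∈ I.dom := by
  cases r with
  | name r => exact I.rI_sub r p h
  | inv r => exact (I.rI_sub r (p.2, p.1) h).symm

theorem concept_dom (I : Interp U) (C : Concept) : Concept.interp I C ⊆ I.dom := by
  induction C with
  | top => exact subset_rfl
  | bot => simp [Concept.interp]
  | atom A => exact I.cI_sub A
  | nom a => exact Set.inter_subset_right
  | neg C ih => exact Set.sdiff_subset
  | conj C D ih1 ih2 => exact fun x hx => ih1 hx.1
  | ex r C ih => rintro d ⟨e, h, _⟩; exact (role_dom I r _ h).1

theorem stepI_dom (I : Interp U) (d : U) (C : Concept) (hd : d ∈ I.dom) :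
    stepI I d C ∈ I.dom := by
  unfold stepI
  split_ifs with h
  · obtain ⟨r, E, _, h2, _⟩ := h.choose_spec
    exact (role_dom I r _ h2).2
  · exact hd

theorem stepI_spec (I : Interp U) (d : U) (r : Role) (E : Concept)
    (hd : d ∈ Concept.interp I (Concept.ex r E)) :
    (d, stepI I d (Concept.ex r E)) ∈ Role.interp I r ∧
      stepI I d (Concept.ex r E) ∈ Concept.interp I E := by
  obtain ⟨e, h1, h2⟩ := hd
  have h : ∃ e r' E', Concept.ex r E = Concept.ex r' E' ∧ (d, e) ∈ Role.interp I r' ∧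
      e ∈ Concept.interp I E' := ⟨e, r, E, rfl, h1, h2⟩
  unfold stepI
  rw [dif_pos h]
  obtain ⟨r', E', h3, h4, h5⟩ := h.choose_spec
  cases h3
  exact ⟨h4, h5⟩

/-- Depth-bounded types. -/
def Ty (B S : Type) : ℕ → Type
  | 0 => B
  | k + 1 => B × (S → Ty B S k)

noncomputable instance instFintypeTy (B S : Type) [Fintype B] [Fintype S] :
    ∀ k, Fintype (Ty B S k)
  | 0 => inferInstanceAs (Fintype B)
  | k + 1 =>
    haveI := instFintypeTy B S k
    inferInstanceAs (Fintype (B × (S → Ty B S k)))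

abbrev Base (D : Finset U) (cl : Finset Concept) (RN : Finset ℕ) : Type :=
  (cl → Prop) × (cl → Option D) × (cl → RN → Prop × Prop)

noncomputable def coreOpt (D : Finset U) (d : U) : Option D :=
  if h : d ∈ D then some ⟨d, h⟩ else none

theorem coreOpt_eq {D : Finset U} {d e : U} (h : coreOpt D d = coreOpt D e) (hd : d ∈ D) :
    e = d := by
  unfold coreOpt at h
  rw [dif_pos hd] at h
  split_ifs at h with h2
  simpa using h.symm

theorem coreOpt_mem {D : Finset U} {d e : U} (h : coreOpt D d = coreOpt D e) :
    d ∈ D ↔ e ∈ D := by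
  constructor
  · intro hd; rw [coreOpt_eq h hd]; exact hd
  · intro hd; rw [coreOpt_eq h.symm hd]; exact hd

noncomputable def base (I : Interp U) (D : Finset U) (cl : Finset Concept) (RN : Finset ℕ)
    (d : U) : Base D cl RN :=
  (fun C => d ∈ Concept.interp I C.1, fun C => coreOpt D (stepI I d C.1),
    fun C r => ((d, stepI I d C.1) ∈ I.rI r.1, (stepI I d C.1, d) ∈ I.rI r.1))

noncomputable def tau (I : Interp U) (D : Finset U) (cl : Finset Concept) (RN : Finset ℕ) :
    (k : ℕ) → U → Ty (Base D cl RN) cl k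
  | 0, d => base I D cl RN d
  | k + 1, d => (base I D cl RN d, fun C => tau I D cl RN k (stepI I d C.1))

theorem tau_base {I : Interp U} {D : Finset U} {cl : Finset Concept} {RN : Finset ℕ}
    {k : ℕ} {d e : U} (h : tau I D cl RN k d = tau I D cl RN k e) :
    base I D cl RN d = base I D cl RN e := by
  cases k with
  | zero => exact h
  | succ k => exact congrArg Prod.fst h

theorem tau_step {I : Interp U} {D : Finset U} {cl : Finset Concept} {RN : Finset ℕ}
    {k : ℕ} {d e : U} (h : tau I D cl RN (k + 1) d = tau I D cl RN (k + 1) e) (C : cl) :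
    tau I D cl RN k (stepI I d C.1) = tau I D cl RN k (stepI I e C.1) :=
  congrFun (congrArg Prod.snd h) C

abbrev Path (D : Finset U) (cl : Finset Concept) : Type := D × List cl

def Path.par {D : Finset U} {cl : Finset Concept} (x : Path D cl) : Path D cl := (x.1, x.2.tail)

def Path.ext' {D : Finset U} {cl : Finset Concept} (x : Path D cl) (i : cl) : Path D cl :=
  (x.1, i :: x.2)

noncomputable def hL (I : Interp U) {D : Finset U} {cl : Finset Concept} (c : D) : List cl → U
  | [] => c.1
  | i :: l => stepI I (hL I c l) i.1

noncomputable def hP (I : Interp U) {D : Finset U} {cl : Finset Concept} (x : Path D cl) : U :=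
  hL I x.1 x.2

abbrev Label (D : Finset U) (cl : Finset Concept) (RN : Finset ℕ) (N : ℕ) : Type :=
  Option D × Option cl × Ty (Base D cl RN) cl N

noncomputable def label (I : Interp U) {D : Finset U} {cl : Finset Concept} (RN : Finset ℕ)
    (N : ℕ) (x : Path D cl) : Label D cl RN N :=
  (coreOpt D (hP I x), x.2.head?, tau I D cl RN N (hP I x))

abbrev Univ (D : Finset U) (cl : Finset Concept) (RN : Finset ℕ) (N : ℕ) : Type :=
  D ⊕ (Fin (N + 1) × (Fin (N + 1) → Label D cl RN N))

noncomputable def cls (I : Interp U) {D : Finset U} {cl : Finset Concept} (RN : Finset ℕ)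
    (N : ℕ) (x : Path D cl) : Fin (N + 1) × (Fin (N + 1) → Label D cl RN N) :=
  (⟨x.2.length % (N + 1), Nat.mod_lt _ (Nat.succ_pos _)⟩,
    fun j => label I RN N (Path.par^[j.1] x))

noncomputable def node (I : Interp U) {D : Finset U} {cl : Finset Concept} (RN : Finset ℕ)
    (N : ℕ) (x : Path D cl) : Univ D cl RN N :=
  if h : hP I x ∈ D then Sum.inl ⟨hP I x, h⟩ else Sum.inr (cls I RN N x)

variable {I : Interp U} {D : Finset U} {cl : Finset Concept} {RN : Finset ℕ} {N : ℕ}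

theorem node_core {x y : Path D cl} (h : node I RN N x = node I RN N y) (hx : hP I x ∈ D) :
    hP I y = hP I x := by
  unfold node at h
  rw [dif_pos hx] at h
  split_ifs at h with h2
  simpa using h.symm

theorem node_of_core {x y : Path D cl} (hx : hP I x ∈ D) (h : hP I y = hP I x) :
    node I RN N x = node I RN N y := by
  have hy : hP I y ∈ D := h ▸ hx
  unfold node
  rw [dif_pos hx, dif_pos hy]
  simp [h]

theorem node_cls {x y : Path D cl} (h : node I RN N x = node I RN N y) (hx : hP I x ∉ D) :
    cls I RN N x = cls I RN N y := by
  unfold node at h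
  rw [dif_neg hx] at h
  split_ifs at h with h2
  simpa using h

theorem node_base {x y : Path D cl} (h : node I RN N x = node I RN N y) :
    base I D cl RN (hP I x) = base I D cl RN (hP I y) := by
  by_cases hx : hP I x ∈ D
  · rw [node_core h hx]
  · have h1 := congrFun (congrArg Prod.snd (node_cls h hx)) 0
    have h2 : label I RN N x = label I RN N y := h1
    exact tau_base (congrArg (fun t => t.2.2) h2)

theorem base_concept {d e : U} (h : base I D cl RN d = base I D cl RN e) {C : Concept}
    (hC : C ∈ cl) : d ∈ Concept.interp I C ↔ e ∈ Concept.interp I C :=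
  iff_of_eq (congrFun (congrArg Prod.fst h) ⟨C, hC⟩)

theorem hP_dom (hD : ∀ d ∈ D, d ∈ I.dom) (x : Path D cl) : hP I x ∈ I.dom := by
  obtain ⟨c, l⟩ := x
  induction l with
  | nil => exact hD _ c.2
  | cons i l ih => exact stepI_dom I _ _ ih

def Adj (x y : Path D cl) : Prop := ∃ i, y = Path.ext' x i

def Linked (I : Interp U) (x y : Path D cl) : Prop :=
  Adj x y ∨ Adj y x ∨ (hP I x ∈ D ∧ hP I y ∈ D)

theorem Linked.symm' {x y : Path D cl} (h : Linked I x y) : Linked I y x := by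
  rcases h with h | h | h
  · exact Or.inr (Or.inl h)
  · exact Or.inl h
  · exact Or.inr (Or.inr h.symm)

/-- The finite interpretation. -/
noncomputable def JJ (I : Interp U) (D : Finset U) (cl : Finset Concept) (RN : Finset ℕ)
    (N : ℕ) (d0 : D) : Interp (Univ D cl RN N) where
  dom := Set.range (node I RN N)
  indI a := node I RN N (if h : I.indI a ∈ D then ⟨I.indI a, h⟩ else d0, [])
  cI A := {u | ∃ x, u = node I RN N x ∧ hP I x ∈ I.cI A}
  rI r := {p | ∃ x y, p = (node I RN N x, node I RN N y) ∧ Linked I x y ∧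
    (hP I x, hP I y) ∈ I.rI r}
  cI_sub := by rintro A u ⟨x, rfl, _⟩; exact ⟨x, rfl⟩
  rI_sub := by rintro r p ⟨x, y, rfl, _⟩; exact ⟨⟨x, rfl⟩, ⟨y, rfl⟩⟩

theorem JJ_ind (d0 : D) {a : ℕ} (ha : I.indI a ∈ D) :
    (JJ I D cl RN N d0).indI a = node I RN N (⟨I.indI a, ha⟩, []) := by
  simp [JJ, ha]

theorem JJ_role (d0 : D) (r : Role) (p) :
    p ∈ Role.interp (JJ I D cl RN N d0) r ↔
    ∃ x y, p = (node I RN N x, node I RN N y) ∧ Linked I x y ∧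
    (hP I x, hP I y) ∈ Role.interp I r := by
  cases r with
  | name r => rfl
  | inv r =>
    obtain ⟨u, v⟩ := p
    constructor
    · rintro ⟨x, y, h, hl, hr⟩
      simp only [Prod.mk.injEq] at h
      exact ⟨y, x, by simp [h], hl.symm', hr⟩
    · rintro ⟨x, y, h, hl, hr⟩
      simp only [Prod.mk.injEq] at h
      exact ⟨y, x, by simp [h], hl.symm', hr⟩

/-- Closure under subconcepts. -/
def SubClosed (cl : Finset Concept) : Prop :=
  (∀ C, Concept.neg C ∈ cl → C ∈ cl) ∧
  (∀ C E, Concept.conj C E ∈ cl → C ∈ cl ∧ E ∈ cl) ∧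
  (∀ r C, Concept.ex r C ∈ cl → C ∈ cl)

theorem JJ_concept (d0 : D) (hD : ∀ d ∈ D, d ∈ I.dom) (hcl : SubClosed cl)
    (hnom : ∀ a, Concept.nom a ∈ cl → I.indI a ∈ D) (C : Concept) (hC : C ∈ cl) :
    ∀ x : Path D cl, node I RN N x ∈ Concept.interp (JJ I D cl RN N d0) C ↔
      hP I x ∈ Concept.interp I C := by
  induction C with
  | top => intro x; exact ⟨fun _ => hP_dom hD x, fun _ => ⟨x, rfl⟩⟩
  | bot => intro x; simp [Concept.interp]
  | atom A =>
    intro x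
    constructor
    · rintro ⟨y, h, hy⟩
      exact (base_concept (node_base h) hC).2 hy
    · intro h; exact ⟨x, rfl, h⟩
  | nom a =>
    intro x
    have ha := hnom a hC
    constructor
    · rintro ⟨h, _⟩
      have h' : node I RN N x = (JJ I D cl RN N d0).indI a := h
      rw [JJ_ind d0 ha] at h'
      exact ⟨node_core h'.symm ha, hP_dom hD x⟩
    · rintro ⟨h, _⟩
      have h' : hP I x = I.indI a := h
      refine ⟨?_, ⟨x, rfl⟩⟩
      show node I RN N x = (JJ I D cl RN N d0).indI a
      rw [JJ_ind d0 ha]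
      exact node_of_core (h' ▸ ha) h'.symm
  | neg C ih =>
    intro x
    have := ih (hcl.1 _ hC) x
    constructor
    · rintro ⟨_, h⟩; exact ⟨hP_dom hD x, fun h' => h (this.2 h')⟩
    · rintro ⟨_, h⟩; exact ⟨⟨x, rfl⟩, fun h' => h (this.1 h')⟩
  | conj C E ih1 ih2 =>
    intro x
    have h := hcl.2.1 _ _ hC
    exact and_congr (ih1 h.1 x) (ih2 h.2 x)
  | ex r C ih =>
    intro x
    have hC' := hcl.2.2 _ _ hC
    constructor
    · rintro ⟨e, hr, he⟩
      obtain ⟨x', y, hp, hl, hr'⟩ := (JJ_role d0 r _).1 hr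
      simp only [Prod.mk.injEq] at hp
      rw [base_concept (node_base hp.1) hC]
      refine ⟨hP I y, hr', (ih hC' y).1 ?_⟩
      rw [← hp.2]; exact he
    · intro h
      obtain ⟨h1, h2⟩ := stepI_spec I _ r C h
      let y : Path D cl := Path.ext' x ⟨_, hC⟩
      refine ⟨node I RN N y, (JJ_role d0 r _).2 ⟨x, y, rfl, Or.inl ⟨_, rfl⟩, h1⟩,
        (ih hC' y).2 h2⟩

theorem JJ_vioCI (d0 : D) (hD : ∀ d ∈ D, d ∈ I.dom) (hcl : SubClosed cl)
    (hnom : ∀ a, Concept.nom a ∈ cl → I.indI a ∈ D) (C E : Concept) (hC : C ∈ cl) (hE : E ∈ cl)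
    (hv : vioCI I C E ⊆ D) :
    (vioCI (JJ I D cl RN N d0) C E).encard ≤ (vioCI I C E).encard := by
  let g : U → Univ D cl RN N := fun d => if h : d ∈ D then Sum.inl ⟨d, h⟩ else Sum.inl d0
  refine le_trans (Set.encard_le_encard (t := g '' vioCI I C E) ?_) (Set.encard_image_le _ _)
  rintro u ⟨h1, h2⟩
  obtain ⟨x, rfl⟩ := concept_dom _ _ h1
  have hx : hP I x ∈ vioCI I C E :=
    ⟨(JJ_concept d0 hD hcl hnom C hC x).1 h1, fun h => h2 ((JJ_concept d0 hD hcl hnom E hE x).2 h)⟩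
  have hxD : hP I x ∈ D := hv hx
  refine ⟨_, hx, ?_⟩
  simp [g, node, hxD]

theorem JJ_vioRI (d0 : D) (r s : Role)
    (hv : ∀ p ∈ vioRI I r s, p.1 ∈ D ∧ p.2 ∈ D) :
    (vioRI (JJ I D cl RN N d0) r s).encard ≤ (vioRI I r s).encard := by
  let g : U → Univ D cl RN N := fun d => if h : d ∈ D then Sum.inl ⟨d, h⟩ else Sum.inl d0
  refine le_trans (Set.encard_le_encard (t := Prod.map g g '' vioRI I r s) ?_)
    (Set.encard_image_le _ _)
  rintro u ⟨h1, h2⟩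
  obtain ⟨x, y, rfl, hl, hr⟩ := (JJ_role d0 r _).1 h1
  have hx : (hP I x, hP I y) ∈ vioRI I r s :=
    ⟨hr, fun h => h2 ((JJ_role d0 s _).2 ⟨x, y, rfl, hl, h⟩)⟩
  obtain ⟨hxD, hyD⟩ := hv _ hx
  refine ⟨_, hx, ?_⟩
  simp only at hxD hyD
  simp [g, node, hxD, hyD]

theorem JJ_assert (d0 : D) (α : Assertion) (hα : ∀ a ∈ α.indNames, I.indI a ∈ D)
    (h : Assertion.sat I α) : Assertion.sat (JJ I D cl RN N d0) α := by
  cases α with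
  | ca A a =>
    have ha := hα a (by simp [Assertion.indNames])
    show (JJ I D cl RN N d0).indI a ∈ _
    rw [JJ_ind d0 ha]
    exact ⟨_, rfl, h⟩
  | ra r a b =>
    have ha := hα a (by simp [Assertion.indNames])
    have hb := hα b (by simp [Assertion.indNames])
    show ((JJ I D cl RN N d0).indI a, (JJ I D cl RN N d0).indI b) ∈ _
    rw [JJ_ind d0 ha, JJ_ind d0 hb]
    exact ⟨_, _, rfl, Or.inr (Or.inr ⟨ha, hb⟩), h⟩

/-! ### The query -/

noncomputable def repT (I : Interp U) (D : Finset U) (cl : Finset Concept) (RN : Finset ℕ)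
    (N : ℕ) (d0 : U) (t : Ty (Base D cl RN) cl N) : U :=
  if h : ∃ d ∈ I.dom, tau I D cl RN N d = t then h.choose else d0

noncomputable def EE (I : Interp U) (RN : Finset ℕ) (N : ℕ) (d0 : D) :
    ℕ → Path D cl → U
  | 0, x => match coreOpt D (hP I x) with
    | some c => c.1
    | none => repT I D cl RN N d0.1 (tau I D cl RN N (hP I x))
  | k + 1, x => match coreOpt D (hP I x), x.2.head? with
    | some c, _ => c.1
    | none, none => d0.1
    | none, some i => stepI I (EE I RN N d0 k x.par) i.1

theorem repT_dom (hD : ∀ d ∈ D, d ∈ I.dom) (d0 : D) (t) : repT I D cl RN N d0.1 t ∈ I.dom := by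
  unfold repT
  split_ifs with h
  · exact h.choose_spec.1
  · exact hD _ d0.2

theorem repT_tau (hD : ∀ d ∈ D, d ∈ I.dom) (d0 : D) (x : Path D cl) :
    tau I D cl RN N (repT I D cl RN N d0.1 (tau I D cl RN N (hP I x))) =
      tau I D cl RN N (hP I x) := by
  have h : ∃ d ∈ I.dom, tau I D cl RN N d = tau I D cl RN N (hP I x) :=
    ⟨_, hP_dom hD x, rfl⟩
  unfold repT
  rw [dif_pos h]
  exact h.choose_spec.2

theorem EE_core (d0 : D) (k : ℕ) (x : Path D cl) (hx : hP I x ∈ D) :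
    EE I RN N d0 k x = hP I x := by
  cases k <;> simp [EE, coreOpt, hx]

theorem EE_zero (d0 : D) (x : Path D cl) (hx : hP I x ∉ D) :
    EE I RN N d0 0 x = repT I D cl RN N d0.1 (tau I D cl RN N (hP I x)) := by
  simp [EE, coreOpt, hx]

theorem EE_step (d0 : D) (k : ℕ) (x : Path D cl) (i : cl) (hx : hP I (x.ext' i) ∉ D) :
    EE I RN N d0 (k + 1) (x.ext' i) = stepI I (EE I RN N d0 k x) i.1 := by
  have h : coreOpt D (hP I (x.ext' i)) = none := by simp [coreOpt, hx]
  simp only [EE, h]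
  rfl

theorem path_cases (x : Path D cl) : hP I x ∈ D ∨ ∃ y i, x = Path.ext' y i := by
  obtain ⟨c, l⟩ := x
  cases l with
  | nil => exact Or.inl c.2
  | cons i l => exact Or.inr ⟨(c, l), i, rfl⟩

theorem EE_dom (hD : ∀ d ∈ D, d ∈ I.dom) (d0 : D) (k : ℕ) :
    ∀ x : Path D cl, EE I RN N d0 k x ∈ I.dom := by
  induction k with
  | zero => 
    intro x
    by_cases hx : hP I x ∈ D
    · rw [EE_core d0 0 x hx]; exact hP_dom hD x
    · rw [EE_zero d0 x hx]; exact repT_dom hD d0 _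
  | succ k ih =>
    intro x
    by_cases hx : hP I x ∈ D
    · rw [EE_core d0 _ x hx]; exact hP_dom hD x
    · obtain h | ⟨y, i, rfl⟩ := path_cases (I := I) x
      · exact absurd h hx
      · rw [EE_step d0 k y i hx]; exact stepI_dom I _ _ (ih y)

theorem EE_tau (hD : ∀ d ∈ D, d ∈ I.dom) (d0 : D) (l : ℕ) :
    ∀ (k : ℕ) (x : Path D cl), k + l = N →
      tau I D cl RN k (EE I RN N d0 l x) = tau I D cl RN k (hP I x) := by
  induction l with
  | zero => 
    intro k x h
    obtain rfl : k = N := h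
    by_cases hx : hP I x ∈ D
    · rw [EE_core d0 0 x hx]
    · rw [EE_zero d0 x hx]; exact repT_tau hD d0 x
  | succ l ih =>
    intro k x h
    by_cases hx : hP I x ∈ D
    · rw [EE_core d0 _ x hx]
    · obtain h' | ⟨y, i, rfl⟩ := path_cases (I := I) x
      · exact absurd h' hx
      · rw [EE_step d0 l y i hx]
        exact tau_step (ih (k + 1) y (by omega)) i

theorem EE_base (hD : ∀ d ∈ D, d ∈ I.dom) (d0 : D) (l : ℕ) (hl : l ≤ N) (x : Path D cl) :
    base I D cl RN (EE I RN N d0 l x) = base I D cl RN (hP I x) :=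
  tau_base (EE_tau hD d0 l (N - l) x (by omega))

theorem EE_congr (d0 : D) (l : ℕ) : ∀ x y : Path D cl,
    (∀ j ≤ l, label I RN N (Path.par^[j] x) = label I RN N (Path.par^[j] y)) →
    EE I RN N d0 l x = EE I RN N d0 l y := by
  induction l with
  | zero =>
    intro x y h
    have h0 : tau I D cl RN N (hP I x) = tau I D cl RN N (hP I y) :=
      congrArg (fun t => t.2.2) (h 0 le_rfl)
    have h1 : coreOpt D (hP I x) = coreOpt D (hP I y) := congrArg (fun t => t.1) (h 0 le_rfl)
    simp only [EE, h0, h1]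
  | succ l ih =>
    intro x y h
    have h0 : coreOpt D (hP I x) = coreOpt D (hP I y) := congrArg (fun t => t.1) (h 0 (by omega))
    have h1 : x.2.head? = y.2.head? := congrArg (fun t => t.2.1) (h 0 (by omega))
    have h2 := ih x.par y.par (fun j hj => h (j + 1) (by omega))
    simp only [EE, h0, h1, h2]

/-- The level of a path. -/
def lev (N o : ℕ) (x : Path D cl) : ℕ := (x.2.length + o) % (N + 1)

noncomputable def Gp (I : Interp U) (RN : Finset ℕ) (N o : ℕ) (d0 : D) (x : Path D cl) : U :=
  EE I RN N d0 (lev N o x + 1) x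

theorem lev_congr {o : ℕ} {x y : Path D cl} (h : cls I RN N x = cls I RN N y) :
    lev N o x = lev N o y := by
  have h1 : x.2.length % (N + 1) = y.2.length % (N + 1) :=
    congrArg (fun t => t.1.1) h
  unfold lev
  rw [Nat.add_mod, h1, ← Nat.add_mod]

theorem lev_step {o : ℕ} {x : Path D cl} {i : cl} (h : lev N o x ≠ N) :
    lev N o (x.ext' i) = lev N o x + 1 := by
  have h1 : lev N o x < N + 1 := Nat.mod_lt _ (Nat.succ_pos _)
  have h2 : lev N o (x.ext' i) = ((x.2.length + o) + 1) % (N + 1) := by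
    simp [lev, Path.ext']; congr 1; omega
  rw [h2, ← Nat.mod_add_mod]
  exact Nat.mod_eq_of_lt (by unfold lev at h h1; omega)

theorem Gp_congr {o : ℕ} (d0 : D) {x y : Path D cl} (h : node I RN N x = node I RN N y)
    (hx : hP I x ∉ D → lev N o x ≠ N) : Gp I RN N o d0 x = Gp I RN N o d0 y := by
  by_cases hxD : hP I x ∈ D
  · have := node_core h hxD
    unfold Gp
    rw [EE_core _ _ _ hxD, EE_core _ _ _ (this ▸ hxD), this]
  · have hc := node_cls h hxD
    have h1 : lev N o x < N + 1 := Nat.mod_lt _ (Nat.succ_pos _)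
    have h2 := hx hxD
    unfold Gp
    rw [← lev_congr hc]
    apply EE_congr
    intro j hj
    exact congrFun (congrArg Prod.snd hc) ⟨j, by omega⟩

theorem Gp_role {o : ℕ} (hD : ∀ d ∈ D, d ∈ I.dom) (d0 : D) {x : Path D cl} {i : cl}
    (hx : hP I x ∉ D → lev N o x ≠ N)
    {r : ℕ} (hr : r ∈ RN) :
    ((hP I x, hP I (x.ext' i)) ∈ I.rI r ↔ (Gp I RN N o d0 x, Gp I RN N o d0 (x.ext' i)) ∈ I.rI r) ∧
    ((hP I (x.ext' i), hP I x) ∈ I.rI r ↔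
      (Gp I RN N o d0 (x.ext' i), Gp I RN N o d0 x) ∈ I.rI r) := by
  by_cases hxD : hP I x ∈ D
  · have e1 : Gp I RN N o d0 x = hP I x := EE_core _ _ _ hxD
    have e2 : Gp I RN N o d0 (x.ext' i) = hP I (x.ext' i) := by
      by_cases hyD : hP I (x.ext' i) ∈ D
      · exact EE_core _ _ _ hyD
      · unfold Gp
        rw [EE_step _ _ _ _ hyD, EE_core _ _ _ hxD]
        rfl
    rw [e1, e2]; exact ⟨Iff.rfl, Iff.rfl⟩
  · have h1 : lev N o x < N + 1 := Nat.mod_lt _ (Nat.succ_pos _)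
    have h2 := hx hxD
    have hb : base I D cl RN (Gp I RN N o d0 x) = base I D cl RN (hP I x) :=
      EE_base hD d0 _ (by omega) x
    have e2 : Gp I RN N o d0 (x.ext' i) = stepI I (Gp I RN N o d0 x) i.1 := by
      by_cases hyD : hP I (x.ext' i) ∈ D
      · have e : Gp I RN N o d0 (x.ext' i) = hP I (x.ext' i) := EE_core _ _ _ hyD
        rw [e]
        have h3 : coreOpt D (stepI I (Gp I RN N o d0 x) i.1) = coreOpt D (stepI I (hP I x) i.1) :=
          congrFun (congrArg (fun t => t.2.1) hb) i
        exact (coreOpt_eq h3.symm hyD).symm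
      · unfold Gp
        rw [EE_step _ _ _ _ hyD, lev_step h2]
    have h4 := congrFun (congrFun (congrArg (fun t => t.2.2) hb) i) ⟨r, hr⟩
    rw [e2]
    exact ⟨(iff_of_eq (congrArg Prod.fst h4)).symm, (iff_of_eq (congrArg Prod.snd h4)).symm⟩

def qVars (q : BCQ) : Finset ℕ := q.biUnion fun a => match a with
  | QAtom.ca _ (Term.var v) => {v}
  | QAtom.ca _ _ => ∅
  | QAtom.ra _ t t' => (match t with | Term.var v => {v} | _ => ∅) ∪
      (match t' with | Term.var v => {v} | _ => ∅)

theorem exists_shift (N : ℕ) (V : Finset ℕ) (hV : V.card ≤ N) (f : ℕ → ℕ) :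
    ∃ o, ∀ v ∈ V, (f v + o) % (N + 1) ≠ N := by
  have h1 : (V.image fun v => f v % (N + 1)).card < (Finset.range (N + 1)).card := by
    rw [Finset.card_range]
    exact lt_of_le_of_lt Finset.card_image_le (by omega)
  obtain ⟨r, hr, hr'⟩ := Finset.exists_mem_notMem_of_card_lt_card h1
  refine ⟨N - r, fun v hv h => hr' ?_⟩
  rw [Finset.mem_image]
  refine ⟨v, hv, ?_⟩
  have hr : r < N + 1 := by simpa using hr
  have h2 : f v + (N - r) ≡ r + (N - r) [MOD N + 1] := by
    unfold Nat.ModEq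
    rw [h, show r + (N - r) = N by omega, Nat.mod_eq_of_lt (by omega)]
  have h3 := Nat.ModEq.add_right_cancel' _ h2
  unfold Nat.ModEq at h3
  rw [h3, Nat.mod_eq_of_lt hr]

theorem JJ_query (d0 : D) (hD : ∀ d ∈ D, d ∈ I.dom) (q : BCQ)
    (hq : ∀ a ∈ qInds q, I.indI a ∈ D)
    (hN : (qVars q).card ≤ N)
    (hc : ∀ A t, QAtom.ca A t ∈ q → Concept.atom A ∈ cl)
    (hr : ∀ r t t', QAtom.ra r t t' ∈ q → r ∈ RN)
    (h : satQ (JJ I D cl RN N d0) q) : satQ I q := by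
  obtain ⟨π, hπ, hsat⟩ := h
  choose x hx using hπ
  obtain ⟨o, ho⟩ := exists_shift N (qVars q) hN (fun v => (x v).2.length)
  let π' : ℕ → U := fun v => Gp I RN N o d0 (x v)
  have hG : ∀ t : Term, t.indNames ⊆ qInds q → (∀ v, t = Term.var v → v ∈ qVars q) →
      ∀ y, t.eval (JJ I D cl RN N d0) π = node I RN N y →
        (t.eval I π' = Gp I RN N o d0 y ∧ (hP I y ∉ D → lev N o y ≠ N)) := by
    intro t ht hv y hy
    cases t with
    | var v =>
      have hy' : node I RN N (x v) = node I RN N y := (hx v).trans hy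
      have hv' := ho v (hv v rfl)
      refine ⟨Gp_congr d0 hy' (fun _ => hv'), fun hyD => ?_⟩
      rw [lev_congr (node_cls hy'.symm hyD)]
      exact hv'
    | ind a =>
      have ha := hq a (ht (by simp [Term.indNames]))
      have hy' : (JJ I D cl RN N d0).indI a = node I RN N y := hy
      rw [JJ_ind d0 ha] at hy'
      have h1 : hP I y = I.indI a := node_core hy' ha
      have h2 : hP I y ∈ D := h1 ▸ ha
      refine ⟨?_, fun h => absurd h2 h⟩
      unfold Gp
      rw [EE_core _ _ _ h2, h1]
      rfl
  refine ⟨π', fun v => EE_dom hD d0 _ _, fun a ha => ?_⟩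
  have hs := hsat a ha
  cases a with
  | ca A t =>
    obtain ⟨y, hy, hyA⟩ := hs
    obtain ⟨e, hl⟩ := hG t
      (fun b hb => Finset.mem_biUnion.2 ⟨_, ha, hb⟩)
      (fun v hv => Finset.mem_biUnion.2 ⟨_, ha, by subst hv; simp⟩) y hy
    show t.eval I π' ∈ I.cI A
    rw [e]
    have h1 : lev N o y < N + 1 := Nat.mod_lt _ (Nat.succ_pos _)
    by_cases hyD : hP I y ∈ D
    · unfold Gp
      rw [EE_core _ _ _ hyD]
      exact hyA
    · have h2 := hl hyD
      exact (base_concept (EE_base hD d0 _ (by omega) y) (hc A t ha)).2 hyA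
  | ra r t t' =>
    obtain ⟨y, z, hyz, hl, hyr⟩ := hs
    simp only [Prod.mk.injEq] at hyz
    obtain ⟨e, hl1⟩ := hG t
      (fun b hb => Finset.mem_biUnion.2 ⟨_, ha, by simp [QAtom.indNames, hb]⟩)
      (fun v hv => Finset.mem_biUnion.2 ⟨_, ha, by subst hv; simp⟩) y hyz.1
    obtain ⟨e', hl2⟩ := hG t'
      (fun b hb => Finset.mem_biUnion.2 ⟨_, ha, by simp [QAtom.indNames, hb]⟩)
      (fun v hv => Finset.mem_biUnion.2 ⟨_, ha, by subst hv; simp⟩) z hyz.2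
    show (t.eval I π', t'.eval I π') ∈ I.rI r
    rw [e, e']
    rcases hl with ⟨i, rfl⟩ | ⟨i, rfl⟩ | ⟨h1, h2⟩
    · exact (Gp_role hD d0 hl1 (hr _ _ _ ha)).1.1 hyr
    · exact (Gp_role hD d0 hl2 (hr _ _ _ ha)).2.1 hyr
    · unfold Gp
      rw [EE_core _ _ _ h1, EE_core _ _ _ h2]
      exact hyr

/-! ### Counting -/

open Polynomial in
noncomputable def tyPoly (m : ℕ) (B : Polynomial ℕ) : ℕ → Polynomial ℕ
  | 0 => B
  | k + 1 => B * (tyPoly m B k) ^ m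

open Polynomial in
noncomputable def basePoly (m ρ : ℕ) : Polynomial ℕ :=
  C (2 ^ m) * ((X + 1) ^ m * C (((2 * 2) ^ ρ) ^ m))

open Polynomial in
noncomputable def univPoly (m ρ N : ℕ) : Polynomial ℕ :=
  X + C (N + 1) * ((X + 1) * (C (m + 1) * tyPoly m (basePoly m ρ) N)) ^ (N + 1)

theorem card_base : Fintype.card (Base D cl RN) = (basePoly cl.card RN.card).eval D.card := by
  simp [Base, basePoly]

theorem card_ty_succ (B S : Type) [Fintype B] [Fintype S] (k : ℕ) :
    Fintype.card (Ty B S (k + 1)) = Fintype.card B * Fintype.card (Ty B S k) ^ Fintype.card S := by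
  have : Fintype.card (Ty B S (k + 1)) =
      Fintype.card (B × (S → Ty B S k)) := Fintype.card_congr (Equiv.refl _)
  rw [this, Fintype.card_prod, Fintype.card_fun]

theorem card_ty (k : ℕ) : Fintype.card (Ty (Base D cl RN) cl k) =
    (tyPoly cl.card (basePoly cl.card RN.card) k).eval D.card := by
  induction k with
  | zero => exact card_base
  | succ k ih =>
    rw [card_ty_succ, card_base, ih]
    simp [tyPoly]

theorem card_univ' : Fintype.card (Univ D cl RN N) =
    (univPoly cl.card RN.card N).eval D.card := by
  simp [Univ, Label, univPoly, card_ty]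

def Concept.subs : Concept → Finset Concept
  | Concept.neg C => insert (Concept.neg C) C.subs
  | Concept.conj C E => insert (Concept.conj C E) (C.subs ∪ E.subs)
  | Concept.ex r C => insert (Concept.ex r C) C.subs
  | C => {C}

theorem subs_self (C : Concept) : C ∈ C.subs := by
  cases C <;> simp [Concept.subs]

theorem subs_closed (C : Concept) : SubClosed C.subs := by
  induction C with
  | top => simp [SubClosed, Concept.subs]
  | bot => simp [SubClosed, Concept.subs]
  | atom => simp [SubClosed, Concept.subs]
  | nom => simp [SubClosed, Concept.subs]
  | neg C ih =>
    have := subs_self C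
    unfold SubClosed at ih ⊢
    simp only [Concept.subs, Finset.mem_insert]
    grind
  | conj C E ih1 ih2 =>
    have := subs_self C
    have := subs_self E
    unfold SubClosed at ih1 ih2 ⊢
    simp only [Concept.subs, Finset.mem_insert, Finset.mem_union]
    grind
  | ex r C ih =>
    have := subs_self C
    unfold SubClosed at ih ⊢
    simp only [Concept.subs, Finset.mem_insert]
    grind

theorem subs_nom (C : Concept) (a : ℕ) (h : Concept.nom a ∈ C.subs) : a ∈ C.indNames := by
  induction C <;> simp_all [Concept.subs, Concept.indNames]
  grind

def Axiom.subs : Axiom → Finset Concept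
  | Axiom.ci C E => C.subs ∪ E.subs
  | Axiom.ri _ _ => ∅

def qAtomC : QAtom → Finset Concept
  | QAtom.ca A _ => {Concept.atom A}
  | QAtom.ra _ _ _ => ∅

def qAtomR : QAtom → Finset ℕ
  | QAtom.ca _ _ => ∅
  | QAtom.ra r _ _ => {r}

noncomputable def clOf (T : Finset Axiom) (q : BCQ) : Finset Concept :=
  T.biUnion Axiom.subs ∪ q.biUnion qAtomC

theorem subClosed_union {s t : Finset Concept} (hs : SubClosed s) (ht : SubClosed t) :
    SubClosed (s ∪ t) := by
  unfold SubClosed at *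
  simp only [Finset.mem_union]
  grind

theorem subClosed_biUnion {ι : Type} [DecidableEq ι] (s : Finset ι) (f : ι → Finset Concept)
    (h : ∀ i, SubClosed (f i)) : SubClosed (s.biUnion f) := by
  unfold SubClosed at *
  simp only [Finset.mem_biUnion]
  grind

theorem clOf_closed (T : Finset Axiom) (q : BCQ) : SubClosed (clOf T q) := by
  refine subClosed_union (subClosed_biUnion _ _ ?_) (subClosed_biUnion _ _ ?_)
  · rintro (⟨C, E⟩ | ⟨r, s⟩)
    · exact subClosed_union (subs_closed C) (subs_closed E)
    · simp [SubClosed, Axiom.subs]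
  · rintro (⟨A, t⟩ | ⟨r, t, t'⟩) <;> simp [SubClosed, qAtomC]

theorem clOf_nom (T : Finset Axiom) (q : BCQ) (a : ℕ) (h : Concept.nom a ∈ clOf T q) :
    a ∈ T.biUnion Axiom.indNames := by
  rcases Finset.mem_union.1 h with h | h
  · obtain ⟨τ, hτ, h⟩ := Finset.mem_biUnion.1 h
    refine Finset.mem_biUnion.2 ⟨τ, hτ, ?_⟩
    cases τ with
    | ci C E =>
      rcases Finset.mem_union.1 h with h | h
      · exact Finset.mem_union_left _ (subs_nom _ _ h)
      · exact Finset.mem_union_right _ (subs_nom _ _ h)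
    | ri r s => simp [Axiom.subs] at h
  · obtain ⟨τ, hτ, h⟩ := Finset.mem_biUnion.1 h
    cases τ <;> simp [qAtomC] at h

/-- Elements involved in a violation. -/
def vset (I : Interp U) : Axiom → Set U
  | Axiom.ci C E => vioCI I C E
  | Axiom.ri r s => Prod.fst '' vioRI I r s ∪ Prod.snd '' vioRI I r s

theorem vset_dom (I : Interp U) (τ : Axiom) : vset I τ ⊆ I.dom := by
  cases τ with
  | ci C E => exact fun x hx => concept_dom I C hx.1
  | ri r s =>
    rintro x (⟨p, hp, rfl⟩ | ⟨p, hp, rfl⟩)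
    · exact (role_dom I r p hp.1).1
    · exact (role_dom I r p hp.1).2

theorem vset_encard (I : Interp U) (τ : Axiom) :
    (vset I τ).encard ≤ 2 * Axiom.vioCount I τ := by
  rw [two_mul]
  cases τ with
  | ci C E => exact le_self_add
  | ri r s =>
    exact (Set.encard_union_le _ _).trans
      (add_le_add (Set.encard_image_le _ _) (Set.encard_image_le _ _))

theorem vioCount_le (I : Interp U) (τ : Axiom) :
    Axiom.vioCount I τ ≤ I.dom.encard + I.dom.encard * I.dom.encard := by
  cases τ with
  | ci C E =>
    exact (Set.encard_le_encard (fun x hx => concept_dom I C hx.1)).trans le_self_add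
  | ri r s =>
    refine le_trans ?_ le_add_self
    rw [← Set.encard_prod]
    exact Set.encard_le_encard (fun p hp => role_dom I r p hp.1)

theorem construct (T : Finset Axiom) (q : BCQ) : ∃ p : Polynomial ℕ,
    ∀ (U : Type) (I : Interp U) (D : Finset U), D.Nonempty → (∀ d ∈ D, d ∈ I.dom) →
      (∀ a ∈ T.biUnion Axiom.indNames ∪ qInds q, I.indI a ∈ D) → ¬ satQ I q →
      ∃ (U' : Type) (J : Interp U'), J.Proper ∧ ¬ satQ J q ∧
        J.dom.encard ≤ ((p.eval D.card : ℕ) : ℕ∞) ∧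
        (∀ α : Assertion, (∀ a ∈ α.indNames, I.indI a ∈ D) →
          Assertion.sat I α → Assertion.sat J α) ∧
        ∀ τ ∈ T, vset I τ ⊆ D → Axiom.vioCount J τ ≤ Axiom.vioCount I τ := by
  let RN := q.biUnion qAtomR
  let N := (qVars q).card
  refine ⟨univPoly (clOf T q).card RN.card N, ?_⟩
  intro U I D ⟨d, hd⟩ hD hi hq
  let d0 : D := ⟨d, hd⟩
  refine ⟨Univ D (clOf T q) RN N, JJ I D (clOf T q) RN N d0, ?_, ?_, ?_, ?_, ?_⟩
  · intro a; exact ⟨_, rfl⟩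
  · intro h
    refine hq (JJ_query d0 hD q (fun a ha => hi a (Finset.mem_union_right _ ha)) le_rfl ?_ ?_ h)
    · intro A t h
      exact Finset.mem_union_right _ (Finset.mem_biUnion.2 ⟨_, h, by simp [qAtomC]⟩)
    · intro r t t' h
      exact Finset.mem_biUnion.2 ⟨_, h, by simp [qAtomR]⟩
  · rw [← card_univ']
    refine (Set.encard_le_encard (Set.subset_univ _)).trans ?_
    rw [Set.encard_univ]
    simp
  · intro α hα h
    exact JJ_assert d0 α hα h
  · intro τ hτ hv
    cases τ with
    | ci C E =>
      refine JJ_vioCI d0 hD (clOf_closed T q) ?_ C E ?_ ?_ hv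
      · exact fun a ha => hi a (Finset.mem_union_left _ (clOf_nom T q a ha))
      · exact Finset.mem_union_left _ (Finset.mem_biUnion.2 ⟨_, hτ,
          Finset.mem_union_left _ (subs_self C)⟩)
      · exact Finset.mem_union_left _ (Finset.mem_biUnion.2 ⟨_, hτ,
          Finset.mem_union_right _ (subs_self E)⟩)
    | ri r s =>
      exact JJ_vioRI d0 r s (fun p hp => ⟨hv (Or.inl ⟨p, hp, rfl⟩), hv (Or.inr ⟨p, hp, rfl⟩)⟩)

theorem aboxInds_card (A : Finset Assertion) : (aboxInds A).card ≤ aboxSize A := by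
  refine Finset.card_biUnion_le.trans (Finset.sum_le_sum fun α _ => ?_)
  cases α with
  | ca B a => simp [Assertion.indNames, Assertion.size]
  | ra r a b => exact Finset.card_le_two.trans (by simp [Assertion.size])

theorem eval_mono (p : Polynomial ℕ) {a b : ℕ} (h : a ≤ b) : p.eval a ≤ p.eval b := by
  rw [Polynomial.eval_eq_sum, Polynomial.eval_eq_sum]
  exact Finset.sum_le_sum fun i _ => Nat.mul_le_mul_left _ (Nat.pow_le_pow_left h i)

theorem abox_cost_le {U' : Type} (A : Finset Assertion) (wA : Assertion → ℕ∞) (I : Interp U)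
    (J : Interp U') (h : ∀ α ∈ A, Assertion.sat I α → Assertion.sat J α) :
    (∑ α ∈ A, (if Assertion.sat J α then 0 else wA α)) ≤
      ∑ α ∈ A, (if Assertion.sat I α then 0 else wA α) := by
  refine Finset.sum_le_sum fun α hα => ?_
  have := h α hα
  split_ifs <;> simp_all

end Construction

/-- For every `ALCHIO` weighted TBox `(T, wT)` and BCQ `q` there is a
polynomial `p` (independent of the weighted ABox and of `k`) such that for every weighted
ABox `(A, wA)` and every integer `k`: if some interpretation `I` has `ω(I) ≤ k` and
`I ⊭ q`, then some interpretation `J` has `ω(J) ≤ k`, `J ⊭ q` and `|Δ^J| ≤ p(|A|)`. -/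
theorem statement1 (T : Finset Axiom) (wT : Axiom → ℕ∞) (hwT : ∀ τ ∈ T, 1 ≤ wT τ)
    (q : BCQ) :
    ∃ p : Polynomial ℕ,
      ∀ (A : Finset Assertion) (wA : Assertion → ℕ∞), (∀ α ∈ A, 1 ≤ wA α) →
        ∀ k : ℕ,
          (∃ (U : Type) (I : Interp U), I.Proper ∧ cost T A wT wA I ≤ (k : ℕ∞) ∧ ¬ satQ I q) →
          ∃ (U' : Type) (J : Interp U'), J.Proper ∧ cost T A wT wA J ≤ (k : ℕ∞) ∧ ¬ satQ J q ∧
            J.dom.encard ≤ ((p.eval (aboxSize A) : ℕ) : ℕ∞) := by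
  classical
  obtain ⟨p1, hp1⟩ := construct T q
  let I0 : Finset ℕ := insert 0 (T.biUnion Axiom.indNames ∪ qInds q)
  let W : ℕ := ∑ τ ∈ T, (wT τ).toNat
  let P0 : Polynomial ℕ := Polynomial.X + Polynomial.C I0.card
  let Q1 : Polynomial ℕ := p1.comp P0
  let B2 : Polynomial ℕ := Polynomial.C W * (Q1 + Q1 * Q1)
  let P1 : Polynomial ℕ := P0 + Polynomial.C T.card * (2 * B2)
  refine ⟨Q1 + p1.comp P1, ?_⟩
  rintro A wA - k ⟨U, I, hI, hcost, hq⟩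
  set a := aboxSize A with ha
  let Inds : Finset ℕ := I0 ∪ aboxInds A
  let D0 : Finset U := Inds.image I.indI
  have hD0 : D0.card ≤ P0.eval a := by
    refine Finset.card_image_le.trans ((Finset.card_union_le _ _).trans ?_)
    have := aboxInds_card A
    simp [P0]; omega
  have hD0dom : ∀ d ∈ D0, d ∈ I.dom := by
    intro d hd
    obtain ⟨b, _, rfl⟩ := Finset.mem_image.1 hd
    exact hI b
  have hD0i : ∀ b ∈ T.biUnion Axiom.indNames ∪ qInds q, I.indI b ∈ D0 := fun b hb =>
    Finset.mem_image_of_mem _ (Finset.mem_union_left _ (Finset.mem_insert_of_mem hb))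
  have hD0a : ∀ α ∈ A, ∀ b ∈ α.indNames, I.indI b ∈ D0 := fun α hα b hb =>
    Finset.mem_image_of_mem _ (Finset.mem_union_right _ (Finset.mem_biUnion.2 ⟨α, hα, hb⟩))
  have hD0n : D0.Nonempty :=
    ⟨I.indI 0, Finset.mem_image_of_mem _ (Finset.mem_union_left _ (Finset.mem_insert_self _ _))⟩
  have hev : (Q1 + p1.comp P1).eval a = p1.eval (P0.eval a) + p1.eval (P1.eval a) := by
    simp [Q1, Polynomial.eval_comp]
  have hB2 : B2.eval a = W * (p1.eval (P0.eval a) + p1.eval (P0.eval a) * p1.eval (P0.eval a)) := by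
    simp [B2, Q1, Polynomial.eval_comp]
  have hTk : (∑ τ ∈ T, wT τ * Axiom.vioCount I τ) ≤ (k : ℕ∞) := le_trans le_self_add hcost
  have hTk' : ∀ τ ∈ T, wT τ * Axiom.vioCount I τ ≤ ∑ τ ∈ T, wT τ * Axiom.vioCount I τ :=
    fun τ hτ => Finset.single_le_sum (f := fun τ => wT τ * Axiom.vioCount I τ)
      (fun _ _ => zero_le) hτ
  by_cases hcase : ((B2.eval a : ℕ) : ℕ∞) ≤ ∑ τ ∈ T, wT τ * Axiom.vioCount I τ
  · obtain ⟨U', J, hJ, hJq, hJd, hJA, hJT⟩ := hp1 U I D0 hD0n hD0dom hD0i hq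
    have hJd' : J.dom.encard ≤ ((p1.eval (P0.eval a) : ℕ) : ℕ∞) :=
      hJd.trans (by exact_mod_cast eval_mono p1 hD0)
    refine ⟨U', J, hJ, ?_, hJq, ?_⟩
    · refine le_trans ?_ hcost
      unfold cost
      refine add_le_add (le_trans ?_ hcase) (abox_cost_le A wA I J fun α hα => hJA α (hD0a α hα))
      rw [hB2]
      set b := p1.eval (P0.eval a)
      have : ((W * (b + b * b) : ℕ) : ℕ∞) = ∑ τ ∈ T, (((wT τ).toNat * (b + b * b) : ℕ) : ℕ∞) := by
        rw [← Nat.cast_sum, ← Finset.sum_mul]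
      rw [this]
      refine Finset.sum_le_sum fun τ hτ => ?_
      by_cases hw : wT τ = ⊤
      · have h0 : Axiom.vioCount I τ = 0 := by
          by_contra h
          have := (hTk' τ hτ).trans hTk
          rw [hw, ENat.top_mul h] at this
          exact absurd this (by simp)
        have hv : vset I τ = ∅ := by
          have := vset_encard I τ
          rw [h0, mul_zero] at this
          simpa using this
        have h1 := hJT τ hτ (by simp [hv])
        rw [h0] at h1
        have h2 : Axiom.vioCount J τ = 0 := le_antisymm h1 (zero_le)
        simp [h2]
      · push_cast
        rw [ENat.natCast_toNat hw]
        gcongr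
        refine (vioCount_le J τ).trans ?_
        gcongr
    · rw [hev]
      exact hJd'.trans (by exact_mod_cast Nat.le_add_right _ _)
  · push Not at hcase
    have hvc : ∀ τ ∈ T, (vset I τ).encard ≤ ((2 * B2.eval a : ℕ) : ℕ∞) := by
      intro τ hτ
      refine (vset_encard I τ).trans ?_
      push_cast
      gcongr
      calc Axiom.vioCount I τ = 1 * Axiom.vioCount I τ := (one_mul _).symm
        _ ≤ wT τ * Axiom.vioCount I τ := by gcongr; exact hwT τ hτ
        _ ≤ _ := (hTk' τ hτ).trans hcase.le
    have hfin : ∀ τ ∈ T, (vset I τ).Finite := fun τ hτ =>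
      Set.finite_of_encard_le_coe (hvc τ hτ)
    let V : Axiom → Finset U := fun τ => if h : (vset I τ).Finite then h.toFinset else ∅
    have hV : ∀ τ ∈ T, (V τ : Set U) = vset I τ := by
      intro τ hτ
      simp [V, hfin τ hτ]
    have hVc : ∀ τ ∈ T, (V τ).card ≤ 2 * B2.eval a := by
      intro τ hτ
      have := hvc τ hτ
      rw [← hV τ hτ, Set.encard_coe_eq_coe_finsetCard] at this
      exact_mod_cast this
    let D1 : Finset U := D0 ∪ T.biUnion V
    have hD1 : D1.card ≤ P1.eval a := by
      refine (Finset.card_union_le _ _).trans ?_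
      have h1 := Finset.card_biUnion_le_card_mul T V _ hVc
      have h2 : P1.eval a = P0.eval a + T.card * (2 * B2.eval a) := by
        simp [P1]
      omega
    have hsub : D0 ⊆ D1 := Finset.subset_union_left
    have hD1dom : ∀ d ∈ D1, d ∈ I.dom := by
      intro d hd
      rcases Finset.mem_union.1 hd with h | h
      · exact hD0dom d h
      · obtain ⟨τ, hτ, h⟩ := Finset.mem_biUnion.1 h
        have h' : d ∈ (V τ : Set U) := h
        rw [hV τ hτ] at h'
        exact vset_dom I τ h'
    obtain ⟨U', J, hJ, hJq, hJd, hJA, hJT⟩ :=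
      hp1 U I D1 (hD0n.mono hsub) hD1dom (fun b hb => hsub (hD0i b hb)) hq
    refine ⟨U', J, hJ, ?_, hJq, ?_⟩
    · refine le_trans ?_ hcost
      unfold cost
      refine add_le_add ?_
        (abox_cost_le A wA I J fun α hα => hJA α (fun b hb => hsub (hD0a α hα b hb)))
      refine Finset.sum_le_sum fun τ hτ => ?_
      gcongr
      refine hJT τ hτ ?_
      rw [← hV τ hτ]
      intro d hd
      exact Finset.mem_union_right _ (Finset.mem_biUnion.2 ⟨τ, hτ, hd⟩)
    · rw [hev]
      refine hJd.trans ?_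
      exact_mod_cast (eval_mono p1 hD1).trans (Nat.le_add_left _ _)

end DL
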